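/- There are no integers w, α, β with w ≥ 1, α > β ≥ 1 and α − β even such that gcd(α, w·β) + gcd(β, w·α) = w·(α − β) + β + 2, where gcd denotes the greatest common divisor. -/

import Mathlib

theorem stmt_7 :
    ¬ ∃ (w α β : ℤ), w ≥ 1 ∧ α > β ∧ β ≥ 1 ∧ Even (α - β) ∧
      (Int.gcd α (w * β) : ℤ) + (Int.gcd β (w * α) : ℤ) = w * (α - β) + β + 2 := by
  rintro ⟨w, α, β, hw, hαβ, hβ, -, h⟩
  have hpos : 0 < w * (α - β) := mul_pos (by linarith) (by linarith)
  have hdvd : (Int.gcd α (w * β) : ℤ) ∣ w * (α - β) := by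
    rw [mul_sub]
    exact dvd_sub ((Int.gcd_dvd_left α (w * β)).mul_left w) (Int.gcd_dvd_right α (w * β))
  have h₁ := Int.le_of_dvd hpos hdvd
  have h₂ := Int.le_of_dvd (by linarith) (Int.gcd_dvd_left β (w * α))
  linarith
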